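/- Suppose p is a probability density on Θ solving the Fredholm equation f(x) = ∫_Θ k(x,θ) p(θ) dθ, and let (p_m) be generated by the iterative scheme from an initial probability density p₀ > 0 on Θ with D(p, p₀) < ∞. Then D(f, f_m) → 0 as m → ∞, where f_m(x) = ∫_Θ k(x,θ) p_m(θ) dθ. -/

import Mathlib

open MeasureTheory Real Filter Set

noncomputable def mix (Θ : Set ℝ) (k : ℝ → ℝ → ℝ) (p : ℝ → ℝ) (x : ℝ) : ℝ :=
  ∫ θ in Θ, k x θ * p θ

noncomputable def KL (S : Set ℝ) (g h : ℝ → ℝ) : ℝ :=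
  ∫ y in S, g y * Real.log (g y / h y)

theorem tendsto_zero_of_add_succ_le (A B : ℕ → ℝ) (hB : ∀ m, 0 ≤ B m) (hA : ∀ m, 0 ≤ A (m + 1))
    (hAB : ∀ m, B m + A (m + 1) ≤ A m) : Tendsto B atTop (nhds 0) := by
  have hsum : ∀ n, ∑ m ∈ Finset.range n, B m + A n ≤ A 0 := by
    intro n
    induction n with
    | zero => simp
    | succ n ih =>
      rw [Finset.sum_range_succ]
      linarith [hAB n]
  have hA' : ∀ n, 0 ≤ A n := fun n => by
    cases n with
    | zero => linarith [hAB 0, hB 0, hA 0]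
    | succ n => exact hA n
  exact (summable_of_sum_range_le hB fun n => by
    linarith [hsum n, hA' n]).tendsto_atTop_zero

theorem integrable_of_lintegral_exp_le_one {Ω : Type*} [MeasurableSpace Ω] {P : Measure Ω}
    [IsProbabilityMeasure P] {a b c : Ω → ℝ} (hb : Measurable b) (hc : Measurable c)
    (ha : Integrable a P) (ha' : Measurable a)
    (hbe : ∫⁻ ω, ENNReal.ofReal (exp (-b ω)) ∂P ≤ 1)
    (hce : ∫⁻ ω, ENNReal.ofReal (exp (-c ω)) ∂P ≤ 1)
    (hze : ∫⁻ ω, ENNReal.ofReal (exp (c ω - a ω + b ω)) ∂P ≤ 1) :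
    Integrable b P ∧ Integrable c P ∧ 0 ≤ ∫ ω, b ω ∂P ∧ 0 ≤ ∫ ω, c ω ∂P ∧
      ∫ ω, b ω ∂P + ∫ ω, c ω ∂P ≤ ∫ ω, a ω ∂P := by
  have key : ∀ g : Ω → ℝ, Measurable g → ∫⁻ ω, ENNReal.ofReal (exp (g ω)) ∂P ≤ 1 →
      Integrable (fun ω => exp (g ω)) P ∧ ∫ ω, exp (g ω) ∂P ≤ 1 := by
    intro g hg hle
    refine ⟨?_, ?_⟩
    · refine ⟨hg.exp.aestronglyMeasurable, ?_⟩
      rw [hasFiniteIntegral_iff_ofReal (Eventually.of_forall fun ω => (exp_pos _).le)]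
      exact hle.trans_lt ENNReal.one_lt_top
    · rw [integral_eq_lintegral_of_nonneg_ae (Eventually.of_forall fun ω => (exp_pos _).le)
        hg.exp.aestronglyMeasurable]
      exact ENNReal.toReal_le_of_le_ofReal zero_le_one (by simpa using hle)
  obtain ⟨hb1, hb2⟩ := key _ hb.neg hbe
  obtain ⟨hc1, hc2⟩ := key _ hc.neg hce
  obtain ⟨hz1, hz2⟩ := key _ ((hc.sub ha').add hb) hze
  simp only [Pi.neg_apply, Pi.add_apply, Pi.sub_apply] at hb1 hb2 hc1 hc2 hz1 hz2
  have hdom : Integrable (fun ω => |a ω| + exp (-b ω) + exp (-c ω) + exp (c ω - a ω + b ω)) P :=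
    ((ha.abs.add hb1).add hc1).add hz1
  have bound : ∀ ω, |b ω| ≤ |a ω| + exp (-b ω) + exp (-c ω) + exp (c ω - a ω + b ω) ∧
      |c ω| ≤ |a ω| + exp (-b ω) + exp (-c ω) + exp (c ω - a ω + b ω) := by
    intro ω
    have h1 := add_one_le_exp (-b ω)
    have h2 := add_one_le_exp (-c ω)
    have h3 := add_one_le_exp (c ω - a ω + b ω)
    have h4 := le_abs_self (a ω)
    have h5 := exp_pos (-b ω)
    have h6 := exp_pos (-c ω)
    have h7 := exp_pos (c ω - a ω + b ω)
    have h8 := abs_nonneg (a ω)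
    rw [abs_le, abs_le]
    refine ⟨⟨?_, ?_⟩, ?_, ?_⟩ <;> linarith
  have hbi : Integrable b P :=
    hdom.mono' hb.aestronglyMeasurable (Eventually.of_forall fun ω => (bound ω).1)
  have hci : Integrable c P :=
    hdom.mono' hc.aestronglyMeasurable (Eventually.of_forall fun ω => (bound ω).2)
  have nonneg : ∀ g : Ω → ℝ, Integrable g P → Integrable (fun ω => exp (g ω)) P →
      ∫ ω, exp (g ω) ∂P ≤ 1 → ∫ ω, g ω ∂P ≤ 0 := by
    intro g hg hge hle
    have h : ∫ ω, (g ω + 1) ∂P ≤ ∫ ω, exp (g ω) ∂P :=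
      integral_mono (hg.add (integrable_const 1)) hge fun ω => add_one_le_exp _
    rw [integral_add hg (integrable_const 1)] at h
    simp at h
    linarith
  have hb3 := nonneg _ hbi.neg hb1 hb2
  have hc3 := nonneg _ hci.neg hc1 hc2
  have hz3 := nonneg _ ((hci.sub ha).add hbi) hz1 hz2
  simp only [Pi.neg_apply, Pi.add_apply, Pi.sub_apply] at hb3 hc3 hz3
  rw [integral_neg] at hb3 hc3
  have hz4 : ∫ ω, (c ω - a ω + b ω) ∂P = ∫ ω, c ω ∂P - ∫ ω, a ω ∂P + ∫ ω, b ω ∂P := by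
    rw [← integral_sub hci ha]
    exact integral_add (hci.sub ha) hbi
  exact ⟨hbi, hci, by linarith, by linarith, by linarith⟩

section Mixture

variable {α β : Type*} [MeasurableSpace α] [MeasurableSpace β] {μ : Measure α} {ν : Measure β}
  {k : α → β → ℝ} {q : β → ℝ}

theorem ofReal_integral_kernel_mul (hk : Measurable (Function.uncurry k))
    (hk0 : ∀ x θ, 0 ≤ k x θ) (hq : Measurable q) (hq0 : 0 ≤ᵐ[ν] q) (x : α) :
    ENNReal.ofReal (∫ θ, k x θ * q θ ∂ν) =
      ENNReal.ofReal (∫⁻ θ, ENNReal.ofReal (k x θ * q θ) ∂ν).toReal := by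
  rw [integral_eq_lintegral_of_nonneg_ae]
  · filter_upwards [hq0] with θ hθ using mul_nonneg (hk0 x θ) hθ
  · exact ((hk.comp measurable_prodMk_left).mul hq).aestronglyMeasurable

theorem measurable_integral_kernel_mul [SFinite ν] (hk : Measurable (Function.uncurry k))
    (hq : Measurable q) : Measurable fun x => ∫ θ, k x θ * q θ ∂ν := by
  have h : Measurable (Function.uncurry fun x θ => k x θ * q θ) := hk.mul (hq.comp measurable_snd)
  exact h.stronglyMeasurable.integral_prod_right.measurable

theorem lintegral_lintegral_kernel_mul [SFinite μ] [SFinite ν]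
    (hk : Measurable (Function.uncurry k))
    (hk0 : ∀ x θ, 0 ≤ k x θ) (hq : Measurable q) (r : α → ENNReal) (hr : Measurable r) :
    ∫⁻ x, r x * ∫⁻ θ, ENNReal.ofReal (k x θ * q θ) ∂ν ∂μ =
      ∫⁻ θ, ENNReal.ofReal (q θ) * ∫⁻ x, r x * ENNReal.ofReal (k x θ) ∂μ ∂ν := by
  have hk' : Measurable (Function.uncurry fun x θ => ENNReal.ofReal (k x θ)) := hk.ennreal_ofReal
  calc _ = ∫⁻ x, ∫⁻ θ, r x * ENNReal.ofReal (k x θ) * ENNReal.ofReal (q θ) ∂ν ∂μ := by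
        refine lintegral_congr fun x => ?_
        rw [← lintegral_const_mul]
        · refine lintegral_congr fun θ => ?_
          rw [ENNReal.ofReal_mul (hk0 x θ), mul_assoc]
        · exact ((hk.comp measurable_prodMk_left).mul hq).ennreal_ofReal
    _ = ∫⁻ θ, ∫⁻ x, r x * ENNReal.ofReal (k x θ) * ENNReal.ofReal (q θ) ∂μ ∂ν :=
        lintegral_lintegral_swap (((hr.comp measurable_fst).mul hk').mul
          (hq.comp measurable_snd).ennreal_ofReal).aemeasurable
    _ = _ := by
        refine lintegral_congr fun θ => ?_
        rw [lintegral_mul_const, mul_comm]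
        exact hr.mul (hk'.comp measurable_prodMk_right)

theorem ae_prod_lintegral_ne_zero [SFinite ν] [SFinite μ] {H : α × β → ENNReal}
    (hH : Measurable H) :
    ∀ᵐ z ∂μ.prod ν, H z ≠ 0 → ∫⁻ θ, H (z.1, θ) ∂ν ≠ 0 := by
  have hI : Measurable fun z : α × β => ∫⁻ θ, H (z.1, θ) ∂ν :=
    hH.lintegral_prod_right'.comp measurable_fst
  have hs : MeasurableSet {z : α × β | H z ≠ 0 → ∫⁻ θ, H (z.1, θ) ∂ν ≠ 0} := by
    have e : {z : α × β | H z ≠ 0 → ∫⁻ θ, H (z.1, θ) ∂ν ≠ 0} =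
        H ⁻¹' {0} ∪ (fun z : α × β => ∫⁻ θ, H (z.1, θ) ∂ν) ⁻¹' {0}ᶜ := by
      ext z
      simp only [mem_ofPred_eq, mem_union, mem_preimage, mem_singleton_iff, mem_compl_iff]
      tauto
    rw [e]
    exact (hH (measurableSet_singleton 0)).union (hI (measurableSet_singleton 0).compl)
  rw [Measure.ae_prod_iff_ae_ae hs]
  refine Eventually.of_forall fun x => ?_
  by_cases h : ∫⁻ θ, H (x, θ) ∂ν = 0
  · filter_upwards [(lintegral_eq_zero_iff (hH.comp measurable_prodMk_left)).1 h] with θ hθ hne using absurd hθ hne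
  · exact Eventually.of_forall fun θ _ => h

theorem ae_prod_integral_kernel_mul_pos [SFinite μ] [SFinite ν]
    (hk : Measurable (Function.uncurry k))
    (hk0 : ∀ x θ, 0 ≤ k x θ) (hq : Measurable q) (hq0 : 0 ≤ᵐ[ν] q) :
    ∀ᵐ z ∂μ.prod ν, 0 < k z.1 z.2 * q z.2 →
      ∫⁻ θ, ENNReal.ofReal (k z.1 θ * q θ) ∂ν ≠ ⊤ → 0 < ∫ θ, k z.1 θ * q θ ∂ν := by
  have hH : Measurable fun z : α × β => ENNReal.ofReal (k z.1 z.2 * q z.2) :=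
    (hk.mul (hq.comp measurable_snd)).ennreal_ofReal
  filter_upwards [ae_prod_lintegral_ne_zero hH] with z hz hpos htop
  rw [← ENNReal.ofReal_pos, ofReal_integral_kernel_mul hk hk0 hq hq0, ENNReal.ofReal_toReal htop]
  exact pos_iff_ne_zero.2 (hz (ENNReal.ofReal_pos.2 hpos).ne')

/-- The densities `f` and `s` solve the Fredholm equation `f x = ∫ θ, k x θ * s θ ∂ν`, where `k` is
a Markov kernel density with respect to `μ`. -/
structure IsFredholmSolution (μ : Measure α) (ν : Measure β) (k : α → β → ℝ) (f : α → ℝ)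
    (s : β → ℝ) : Prop where
  measurable_kernel : Measurable (Function.uncurry k)
  kernel_nonneg : ∀ x θ, 0 ≤ k x θ
  lintegral_kernel : ∀ᵐ θ ∂ν, ∫⁻ x, ENNReal.ofReal (k x θ) ∂μ = 1
  measurable_data : Measurable f
  data_nonneg : 0 ≤ᵐ[μ] f
  measurable_solution : Measurable s
  solution_nonneg : 0 ≤ᵐ[ν] s
  lintegral_solution : ∫⁻ θ, ENNReal.ofReal (s θ) ∂ν = 1
  equation : ∀ᵐ x ∂μ, f x = ∫ θ, k x θ * s θ ∂ν

/-- The joint law of the observation and the mixing parameter. -/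
noncomputable def jointLaw (μ : Measure α) (ν : Measure β) (k : α → β → ℝ) (s : β → ℝ) :
    Measure (α × β) :=
  (μ.prod ν).withDensity fun z => ENNReal.ofReal (k z.1 z.2 * s z.2)

theorem jointLaw_absolutelyContinuous {s : β → ℝ} : jointLaw μ ν k s ≪ μ.prod ν :=
  withDensity_absolutelyContinuous _ _

namespace IsFredholmSolution

variable {f : α → ℝ} {s : β → ℝ} [SFinite μ] [SFinite ν]

theorem lintegral_mixture (h : IsFredholmSolution μ ν k f s) (hq : Measurable q) :
    ∫⁻ x, ∫⁻ θ, ENNReal.ofReal (k x θ * q θ) ∂ν ∂μ = ∫⁻ θ, ENNReal.ofReal (q θ) ∂ν := by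
  have := lintegral_lintegral_kernel_mul (μ := μ) (ν := ν) h.measurable_kernel h.kernel_nonneg hq
    (fun _ => 1) measurable_const
  simp only [one_mul] at this
  rw [this]
  refine lintegral_congr_ae ?_
  filter_upwards [h.lintegral_kernel] with θ hθ
  rw [hθ, mul_one]

theorem ae_mixture_ne_top (h : IsFredholmSolution μ ν k f s) (hq : Measurable q)
    (hq1 : ∫⁻ θ, ENNReal.ofReal (q θ) ∂ν ≤ 1) :
    ∀ᵐ x ∂μ, ∫⁻ θ, ENNReal.ofReal (k x θ * q θ) ∂ν ≠ ⊤ := by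
  have hm : Measurable (Function.uncurry fun x θ => ENNReal.ofReal (k x θ * q θ)) :=
    (h.measurable_kernel.mul (hq.comp measurable_snd)).ennreal_ofReal
  have := ae_lt_top (μ := μ) hm.lintegral_prod_right'
    ((h.lintegral_mixture hq).trans_lt (hq1.trans_lt ENNReal.one_lt_top)).ne
  filter_upwards [this] with x hx using hx.ne

theorem lintegral_joint (h : IsFredholmSolution μ ν k f s) {r : α → ENNReal} {g : β → ENNReal}
    (hr : Measurable r) (hg : Measurable g) :
    ∫⁻ z, r z.1 * g z.2 ∂jointLaw μ ν k s =
      ∫⁻ θ, ENNReal.ofReal (s θ) * (g θ * ∫⁻ x, r x * ENNReal.ofReal (k x θ) ∂μ) ∂ν := by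
  have hks : Measurable fun z : α × β => ENNReal.ofReal (k z.1 z.2 * s z.2) :=
    (h.measurable_kernel.mul (h.measurable_solution.comp measurable_snd)).ennreal_ofReal
  have hrg : Measurable fun z : α × β => r z.1 * g z.2 :=
    (hr.comp measurable_fst).mul (hg.comp measurable_snd)
  rw [jointLaw, lintegral_withDensity_eq_lintegral_mul _ hks hrg,
    lintegral_prod_symm' _ (hks.mul hrg)]
  refine lintegral_congr fun θ => ?_
  have hrk : Measurable fun x => r x * ENNReal.ofReal (k x θ) :=
    hr.mul (h.measurable_kernel.comp measurable_prodMk_right).ennreal_ofReal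
  rw [← mul_assoc, ← lintegral_const_mul _ hrk]
  refine lintegral_congr fun x => ?_
  simp only [Pi.mul_apply]
  rw [ENNReal.ofReal_mul (h.kernel_nonneg x θ)]
  ring

theorem map_snd_joint (h : IsFredholmSolution μ ν k f s) :
    (jointLaw μ ν k s).map Prod.snd = ν.withDensity fun θ => ENNReal.ofReal (s θ) := by
  refine Measure.ext_of_lintegral _ fun g hg => ?_
  rw [lintegral_map hg measurable_snd,
    lintegral_withDensity_eq_lintegral_mul _ h.measurable_solution.ennreal_ofReal hg]
  have := h.lintegral_joint (r := fun _ => 1) measurable_const hg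
  simp only [one_mul] at this
  rw [this]
  refine lintegral_congr_ae ?_
  filter_upwards [h.lintegral_kernel] with θ hθ
  simp [hθ]

theorem map_fst_joint (h : IsFredholmSolution μ ν k f s) :
    (jointLaw μ ν k s).map Prod.fst = μ.withDensity fun x => ENNReal.ofReal (f x) := by
  refine Measure.ext_of_lintegral _ fun r hr => ?_
  rw [lintegral_map hr measurable_fst,
    lintegral_withDensity_eq_lintegral_mul _ h.measurable_data.ennreal_ofReal hr]
  have := h.lintegral_joint hr (g := fun _ => 1) measurable_const
  simp only [mul_one, one_mul] at this
  rw [this, ← lintegral_lintegral_kernel_mul h.measurable_kernel h.kernel_nonneg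
    h.measurable_solution r hr]
  refine lintegral_congr_ae ?_
  filter_upwards [h.equation, h.ae_mixture_ne_top h.measurable_solution h.lintegral_solution.le]
    with x hx htop
  rw [Pi.mul_apply, hx, ofReal_integral_kernel_mul h.measurable_kernel h.kernel_nonneg
    h.measurable_solution h.solution_nonneg, ENNReal.ofReal_toReal htop, mul_comm]

theorem isProbabilityMeasure_joint (h : IsFredholmSolution μ ν k f s) :
    IsProbabilityMeasure (jointLaw μ ν k s) := by
  refine ⟨?_⟩
  rw [← preimage_univ (f := Prod.snd), ← Measure.map_apply measurable_snd .univ, h.map_snd_joint,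
    withDensity_apply _ .univ, Measure.restrict_univ, h.lintegral_solution]

theorem lintegral_data (h : IsFredholmSolution μ ν k f s) :
    ∫⁻ x, ENNReal.ofReal (f x) ∂μ = 1 := by
  have := h.isProbabilityMeasure_joint.measure_univ
  rwa [← preimage_univ (f := Prod.fst), ← Measure.map_apply measurable_fst .univ, h.map_fst_joint,
    withDensity_apply _ .univ, Measure.restrict_univ] at this

omit [SFinite μ] [SFinite ν] in
theorem joint_ae_of_ae_fst {A : α → Prop} (hA : ∀ᵐ x ∂μ, A x) :
    ∀ᵐ z ∂jointLaw μ ν k s, A z.1 :=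
  jointLaw_absolutelyContinuous.ae_le (Measure.quasiMeasurePreserving_fst.ae hA)

omit [SFinite μ] [SFinite ν] in
theorem joint_ae_of_ae_snd {A : β → Prop} (hA : ∀ᵐ θ ∂ν, A θ) :
    ∀ᵐ z ∂jointLaw μ ν k s, A z.2 :=
  jointLaw_absolutelyContinuous.ae_le (Measure.quasiMeasurePreserving_snd.ae hA)

theorem joint_ae_pos (h : IsFredholmSolution μ ν k f s) :
    ∀ᵐ z ∂jointLaw μ ν k s, 0 < k z.1 z.2 ∧ 0 < s z.2 ∧ 0 < f z.1 := by
  have hks : Measurable fun z : α × β => ENNReal.ofReal (k z.1 z.2 * s z.2) :=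
    (h.measurable_kernel.mul (h.measurable_solution.comp measurable_snd)).ennreal_ofReal
  have hpos : ∀ᵐ z ∂jointLaw μ ν k s, 0 < k z.1 z.2 * s z.2 := by
    rw [jointLaw, ae_withDensity_iff hks]
    exact Eventually.of_forall fun z hz => ENNReal.ofReal_pos.1 (pos_iff_ne_zero.2 hz)
  filter_upwards [hpos, joint_ae_of_ae_fst h.equation,
    joint_ae_of_ae_fst (h.ae_mixture_ne_top h.measurable_solution h.lintegral_solution.le),
    jointLaw_absolutelyContinuous.ae_le (ae_prod_integral_kernel_mul_pos (μ := μ)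
      h.measurable_kernel h.kernel_nonneg h.measurable_solution h.solution_nonneg)]
    with z hz heq htop himp
  have hk := (h.kernel_nonneg z.1 z.2).lt_of_ne fun h0 => by simp [← h0] at hz
  exact ⟨hk, pos_of_mul_pos_right hz hk.le, heq ▸ himp hz htop⟩

end IsFredholmSolution

/-- `q` is a subprobability density with respect to `ν` that is positive almost everywhere for the
measure `J` on pairs. -/
structure IsPositiveSubdensity (ν : Measure β) (J : Measure (α × β)) (q : β → ℝ) : Prop where
  measurable : Measurable q
  nonneg : 0 ≤ᵐ[ν] q
  lintegral_le_one : ∫⁻ θ, ENNReal.ofReal (q θ) ∂ν ≤ 1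
  ae_pos : ∀ᵐ z ∂J, 0 < q z.2

namespace IsFredholmSolution

variable {f : α → ℝ} {s q' : β → ℝ} [SFinite μ] [SFinite ν]

theorem joint_ae_mixture_pos (h : IsFredholmSolution μ ν k f s)
    (hq : IsPositiveSubdensity ν (jointLaw μ ν k s) q) :
    ∀ᵐ z ∂jointLaw μ ν k s, 0 < ∫ θ, k z.1 θ * q θ ∂ν := by
  filter_upwards [h.joint_ae_pos, hq.ae_pos,
    joint_ae_of_ae_fst (h.ae_mixture_ne_top hq.measurable hq.lintegral_le_one),
    jointLaw_absolutelyContinuous.ae_le (ae_prod_integral_kernel_mul_pos (μ := μ)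
      h.measurable_kernel h.kernel_nonneg hq.measurable hq.nonneg)]
    with z hz hqz htop himp using himp (mul_pos hz.1 hqz) htop

omit [SFinite μ] in
theorem measurable_ratio (h : IsFredholmSolution μ ν k f s) (hq : Measurable q) :
    Measurable fun x => f x / ∫ θ, k x θ * q θ ∂ν :=
  h.measurable_data.div (measurable_integral_kernel_mul h.measurable_kernel hq)

omit [SFinite μ] [SFinite ν] in
theorem ratio_nonneg (h : IsFredholmSolution μ ν k f s) (hq0 : 0 ≤ᵐ[ν] q) :
    0 ≤ᵐ[μ] fun x => f x / ∫ θ, k x θ * q θ ∂ν := by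
  filter_upwards [h.data_nonneg] with x hx
  refine div_nonneg hx (integral_nonneg_of_ae ?_)
  filter_upwards [hq0] with θ hθ using mul_nonneg (h.kernel_nonneg x θ) hθ

theorem lintegral_update_le_one (h : IsFredholmSolution μ ν k f s)
    (hq : IsPositiveSubdensity ν (jointLaw μ ν k s) q) :
    ∫⁻ θ, ENNReal.ofReal (q θ) *
      ∫⁻ x, ENNReal.ofReal (k x θ * (f x / ∫ θ', k x θ' * q θ' ∂ν)) ∂μ ∂ν ≤ 1 := by
  have hr := h.measurable_ratio (ν := ν) hq.measurable
  have e := lintegral_lintegral_kernel_mul (μ := μ) (ν := ν) h.measurable_kernel h.kernel_nonneg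
    hq.measurable _ hr.ennreal_ofReal
  calc _ = ∫⁻ x, ENNReal.ofReal (f x / ∫ θ, k x θ * q θ ∂ν) *
        ∫⁻ θ, ENNReal.ofReal (k x θ * q θ) ∂ν ∂μ := by
        rw [e]
        refine lintegral_congr fun θ => ?_
        congr 1
        refine lintegral_congr fun x => ?_
        rw [ENNReal.ofReal_mul (h.kernel_nonneg x θ), mul_comm]
    _ ≤ ∫⁻ x, ENNReal.ofReal (f x) ∂μ := by
        refine lintegral_mono_ae ?_
        filter_upwards [h.ae_mixture_ne_top hq.measurable hq.lintegral_le_one,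
          h.ratio_nonneg hq.nonneg, h.data_nonneg] with x htop hrx hfx
        rw [← ENNReal.ofReal_toReal htop, ← ofReal_integral_kernel_mul h.measurable_kernel
          h.kernel_nonneg hq.measurable hq.nonneg, ← ENNReal.ofReal_mul hrx]
        refine ENNReal.ofReal_le_ofReal ?_
        rcases eq_or_ne (∫ θ, k x θ * q θ ∂ν) 0 with h0 | h0
        · simpa [h0] using hfx
        · rw [div_mul_cancel₀ _ h0]
    _ = 1 := h.lintegral_data

theorem ae_update_ne_top (h : IsFredholmSolution μ ν k f s)
    (hq : IsPositiveSubdensity ν (jointLaw μ ν k s) q) :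
    ∀ᵐ θ ∂ν, 0 < q θ →
      ∫⁻ x, ENNReal.ofReal (k x θ * (f x / ∫ θ', k x θ' * q θ' ∂ν)) ∂μ ≠ ⊤ := by
  have hr := h.measurable_ratio (ν := ν) hq.measurable
  have hm : Measurable fun z : α × β =>
      ENNReal.ofReal (k z.1 z.2 * (f z.1 / ∫ θ', k z.1 θ' * q θ' ∂ν)) :=
    (h.measurable_kernel.mul (hr.comp measurable_fst)).ennreal_ofReal
  have := ae_lt_top (μ := ν) (hq.measurable.ennreal_ofReal.mul hm.lintegral_prod_left')
    ((h.lintegral_update_le_one hq).trans_lt ENNReal.one_lt_top).ne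
  filter_upwards [this] with θ hθ hpos htop
  simp [htop, ENNReal.mul_top (ENNReal.ofReal_pos.2 hpos).ne'] at hθ

theorem ofReal_update (h : IsFredholmSolution μ ν k f s)
    (hq : IsPositiveSubdensity ν (jointLaw μ ν k s) q)
    (hu : ∀ᵐ θ ∂ν, q' θ = q θ * ∫ x, k x θ * (f x / ∫ θ', k x θ' * q θ' ∂ν) ∂μ) :
    ∀ᵐ θ ∂ν, ENNReal.ofReal (q' θ) = ENNReal.ofReal (q θ) *
      ∫⁻ x, ENNReal.ofReal (k x θ * (f x / ∫ θ', k x θ' * q θ' ∂ν)) ∂μ := by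
  filter_upwards [hu, hq.nonneg, h.ae_update_ne_top hq] with θ hθ hq0 htop
  rw [hθ, ENNReal.ofReal_mul hq0]
  rcases hq0.eq_or_lt with h0 | h0
  · simp [← h0]
  · rw [ofReal_integral_kernel_mul (k := fun θ x => k x θ)
      (h.measurable_kernel.comp measurable_swap) (fun θ x => h.kernel_nonneg x θ)
      (h.measurable_ratio hq.measurable) (h.ratio_nonneg hq.nonneg),
      ENNReal.ofReal_toReal (htop h0)]

theorem isPositiveSubdensity_update (h : IsFredholmSolution μ ν k f s)
    (hq : IsPositiveSubdensity ν (jointLaw μ ν k s) q) (hq'm : Measurable q')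
    (hu : ∀ᵐ θ ∂ν, q' θ = q θ * ∫ x, k x θ * (f x / ∫ θ', k x θ' * q θ' ∂ν) ∂μ) :
    IsPositiveSubdensity ν (jointLaw μ ν k s) q' where
  measurable := hq'm
  nonneg := by
    filter_upwards [hu, hq.nonneg] with θ hθ hq0
    rw [Pi.zero_apply, hθ]
    refine mul_nonneg hq0 (integral_nonneg_of_ae ?_)
    filter_upwards [h.ratio_nonneg hq.nonneg] with x hx using mul_nonneg (h.kernel_nonneg x θ) hx
  lintegral_le_one := by
    rw [lintegral_congr_ae (h.ofReal_update hq hu)]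
    exact h.lintegral_update_le_one hq
  ae_pos := by
    have hpos := ae_prod_integral_kernel_mul_pos (μ := ν) (ν := μ) (k := fun θ x => k x θ)
      (h.measurable_kernel.comp measurable_swap) (fun θ x => h.kernel_nonneg x θ)
      (h.measurable_ratio hq.measurable) (h.ratio_nonneg hq.nonneg)
    filter_upwards [h.joint_ae_pos, hq.ae_pos, h.joint_ae_mixture_pos hq, joint_ae_of_ae_snd hu,
      joint_ae_of_ae_snd (h.ae_update_ne_top hq), jointLaw_absolutelyContinuous.ae_le
        (Measure.measurePreserving_swap.quasiMeasurePreserving.ae hpos)]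
      with z hz hqz hmz huz htop himp
    rw [huz]
    exact mul_pos hqz (himp (mul_pos hz.1 (div_pos hz.2.2 hmz)) (htop hqz))

theorem lintegral_mixture_div_data_le_one (h : IsFredholmSolution μ ν k f s)
    (hq : IsPositiveSubdensity ν (jointLaw μ ν k s) q) :
    ∫⁻ z, ENNReal.ofReal ((∫ θ, k z.1 θ * q θ ∂ν) / f z.1) ∂jointLaw μ ν k s ≤ 1 := by
  have hF := measurable_integral_kernel_mul (ν := ν) h.measurable_kernel hq.measurable
  have hd : Measurable fun x => ENNReal.ofReal ((∫ θ, k x θ * q θ ∂ν) / f x) :=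
    (hF.div h.measurable_data).ennreal_ofReal
  rw [← lintegral_map hd measurable_fst, h.map_fst_joint,
    lintegral_withDensity_eq_lintegral_mul _ h.measurable_data.ennreal_ofReal hd]
  refine le_trans ?_ ((h.lintegral_mixture hq.measurable).trans_le hq.lintegral_le_one)
  refine lintegral_mono_ae ?_
  filter_upwards [h.data_nonneg] with x hx
  rw [Pi.mul_apply, ← ENNReal.ofReal_mul hx]
  rcases hx.eq_or_lt with h0 | h0
  · simp [← h0]
  · rw [mul_div_cancel₀ _ h0.ne', ofReal_integral_kernel_mul h.measurable_kernel h.kernel_nonneg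
      hq.measurable hq.nonneg]
    exact ENNReal.ofReal_toReal_le

theorem lintegral_div_solution_le_one (h : IsFredholmSolution μ ν k f s)
    (hq : IsPositiveSubdensity ν (jointLaw μ ν k s) q) :
    ∫⁻ z, ENNReal.ofReal (q z.2 / s z.2) ∂jointLaw μ ν k s ≤ 1 := by
  have hd : Measurable fun θ => ENNReal.ofReal (q θ / s θ) :=
    (hq.measurable.div h.measurable_solution).ennreal_ofReal
  rw [← lintegral_map hd measurable_snd, h.map_snd_joint,
    lintegral_withDensity_eq_lintegral_mul _ h.measurable_solution.ennreal_ofReal hd]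
  refine le_trans (lintegral_mono_ae ?_) hq.lintegral_le_one
  filter_upwards [h.solution_nonneg] with θ hθ
  rw [Pi.mul_apply, ← ENNReal.ofReal_mul hθ]
  rcases hθ.eq_or_lt with h0 | h0
  · simp [← h0]
  · rw [mul_div_cancel₀ _ h0.ne']

theorem lintegral_ratio_mul_ratio_le_one (h : IsFredholmSolution μ ν k f s)
    (hq : IsPositiveSubdensity ν (jointLaw μ ν k s) q) (hq'm : Measurable q')
    (hu : ∀ᵐ θ ∂ν, q' θ = q θ * ∫ x, k x θ * (f x / ∫ θ', k x θ' * q θ' ∂ν) ∂μ) :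
    ∫⁻ z, ENNReal.ofReal (f z.1 / ∫ θ, k z.1 θ * q θ ∂ν) * ENNReal.ofReal (q z.2 / q' z.2)
      ∂jointLaw μ ν k s ≤ 1 := by
  rw [h.lintegral_joint (g := fun θ => ENNReal.ofReal (q θ / q' θ))
    (h.measurable_ratio hq.measurable).ennreal_ofReal (hq.measurable.div hq'm).ennreal_ofReal]
  refine le_trans (lintegral_mono_ae ?_) h.lintegral_solution.le
  filter_upwards [h.ofReal_update hq hu, hq.nonneg,
    (h.isPositiveSubdensity_update hq hq'm hu).nonneg] with θ hθ hq0 hq'0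
  refine mul_le_of_le_one_right' ?_
  have e : ∫⁻ x, ENNReal.ofReal (f x / ∫ θ', k x θ' * q θ' ∂ν) * ENNReal.ofReal (k x θ) ∂μ =
      ∫⁻ x, ENNReal.ofReal (k x θ * (f x / ∫ θ', k x θ' * q θ' ∂ν)) ∂μ := by
    refine lintegral_congr fun x => ?_
    rw [ENNReal.ofReal_mul (h.kernel_nonneg x θ), mul_comm]
  rw [e, div_eq_inv_mul, ENNReal.ofReal_mul (inv_nonneg.2 hq'0), mul_assoc, ← hθ,
    ← ENNReal.ofReal_mul (inv_nonneg.2 hq'0)]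
  exact ENNReal.ofReal_le_one.2 inv_mul_le_one

theorem relative_entropy_step (h : IsFredholmSolution μ ν k f s)
    (hq : IsPositiveSubdensity ν (jointLaw μ ν k s) q) (hq'm : Measurable q')
    (hu : ∀ᵐ θ ∂ν, q' θ = q θ * ∫ x, k x θ * (f x / ∫ θ', k x θ' * q θ' ∂ν) ∂μ)
    (ha : Integrable (fun z => log (s z.2 / q z.2)) (jointLaw μ ν k s)) :
    Integrable (fun z => log (s z.2 / q' z.2)) (jointLaw μ ν k s) ∧
      0 ≤ ∫ z, log (f z.1 / ∫ θ, k z.1 θ * q θ ∂ν) ∂jointLaw μ ν k s ∧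
      0 ≤ ∫ z, log (s z.2 / q' z.2) ∂jointLaw μ ν k s ∧
      ∫ z, log (f z.1 / ∫ θ, k z.1 θ * q θ ∂ν) ∂jointLaw μ ν k s +
        ∫ z, log (s z.2 / q' z.2) ∂jointLaw μ ν k s ≤
          ∫ z, log (s z.2 / q z.2) ∂jointLaw μ ν k s := by
  have hq' := h.isPositiveSubdensity_update hq hq'm hu
  have := h.isProbabilityMeasure_joint
  have hs := h.measurable_solution
  refine (integrable_of_lintegral_exp_le_one (P := jointLaw μ ν k s)
    ((h.measurable_ratio hq.measurable).comp measurable_fst).log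
    ((hs.div hq'm).comp measurable_snd).log ha
    ((hs.div hq.measurable).comp measurable_snd).log ?_ ?_ ?_).2
  · refine le_trans (lintegral_mono_ae ?_) (h.lintegral_mixture_div_data_le_one hq)
    filter_upwards [h.joint_ae_pos, h.joint_ae_mixture_pos hq] with z hz hm
    simp only [Function.comp_apply]
    rw [← log_inv, inv_div, exp_log (div_pos hm hz.2.2)]
  · refine le_trans (lintegral_mono_ae ?_) (h.lintegral_div_solution_le_one hq')
    filter_upwards [h.joint_ae_pos, hq'.ae_pos] with z hz hm
    simp only [Function.comp_apply, Pi.div_apply]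
    rw [← log_inv, inv_div, exp_log (div_pos hm hz.2.1)]
  · refine le_trans (lintegral_mono_ae ?_) (h.lintegral_ratio_mul_ratio_le_one hq hq'm hu)
    filter_upwards [h.joint_ae_pos, h.joint_ae_mixture_pos hq, hq.ae_pos, hq'.ae_pos]
      with z hz hm hqz hqz'
    have hs0 := hz.2.1
    simp only [Function.comp_apply, Pi.div_apply]
    rw [exp_add, exp_sub, exp_log (div_pos hs0 hqz'), exp_log (div_pos hs0 hqz),
      exp_log (div_pos hz.2.2 hm), ← ENNReal.ofReal_mul (div_pos hz.2.2 hm).le]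
    refine ENNReal.ofReal_le_ofReal (le_of_eq ?_)
    field_simp

theorem integral_fst_joint (h : IsFredholmSolution μ ν k f s) {b : α → ℝ} (hb : Measurable b) :
    ∫ z, b z.1 ∂jointLaw μ ν k s = ∫ x, f x * b x ∂μ := by
  rw [← integral_map measurable_fst.aemeasurable hb.aestronglyMeasurable, h.map_fst_joint,
    integral_withDensity_eq_integral_toReal_smul h.measurable_data.ennreal_ofReal
      (Eventually.of_forall fun _ => ENNReal.ofReal_lt_top)]
  refine integral_congr_ae ?_
  filter_upwards [h.data_nonneg] with x hx
  rw [ENNReal.toReal_ofReal hx, smul_eq_mul]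

theorem integrable_snd_joint (h : IsFredholmSolution μ ν k f s) {a : β → ℝ}
    (hi : Integrable (fun θ => s θ * a θ) ν) :
    Integrable (fun z => a z.2) (jointLaw μ ν k s) := by
  have : Integrable a ((jointLaw μ ν k s).map Prod.snd) := by
    rw [h.map_snd_joint, integrable_withDensity_iff_integrable_smul'
      h.measurable_solution.ennreal_ofReal (Eventually.of_forall fun _ => ENNReal.ofReal_lt_top)]
    refine hi.congr ?_
    filter_upwards [h.solution_nonneg] with θ hθ
    rw [ENNReal.toReal_ofReal hθ, smul_eq_mul]
  exact this.comp_measurable measurable_snd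

theorem tendsto_relative_entropy_mixture (h : IsFredholmSolution μ ν k f s) {p : ℕ → β → ℝ}
    (hp : ∀ m, Measurable (p m)) (hp0 : IsPositiveSubdensity ν (jointLaw μ ν k s) (p 0))
    (hu : ∀ m, ∀ᵐ θ ∂ν, p (m + 1) θ =
      p m θ * ∫ x, k x θ * (f x / ∫ θ', k x θ' * p m θ' ∂ν) ∂μ)
    (hi : Integrable (fun θ => s θ * log (s θ / p 0 θ)) ν) :
    Tendsto (fun m => ∫ x, f x * log (f x / ∫ θ, k x θ * p m θ ∂ν) ∂μ) atTop (nhds 0) := by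
  have hsub : ∀ m, IsPositiveSubdensity ν (jointLaw μ ν k s) (p m) := by
    intro m
    induction m with
    | zero => exact hp0
    | succ m ih => exact h.isPositiveSubdensity_update ih (hp _) (hu m)
  have hint : ∀ m, Integrable (fun z => log (s z.2 / p m z.2)) (jointLaw μ ν k s) := by
    intro m
    induction m with
    | zero => exact h.integrable_snd_joint (a := fun θ => log (s θ / p 0 θ)) hi
    | succ m ih => exact (h.relative_entropy_step (hsub m) (hp _) (hu m) ih).1
  have hb : ∀ m, ∫ x, f x * log (f x / ∫ θ, k x θ * p m θ ∂ν) ∂μ =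
      ∫ z, log (f z.1 / ∫ θ, k z.1 θ * p m θ ∂ν) ∂jointLaw μ ν k s := fun m =>
    (h.integral_fst_joint (b := fun x => log (f x / ∫ θ, k x θ * p m θ ∂ν))
      (h.measurable_ratio (hp m)).log).symm
  have hstep := fun m => (h.relative_entropy_step (hsub m) (hp _) (hu m) (hint m)).2
  simp only [← hb] at hstep
  exact tendsto_zero_of_add_succ_le (fun m => ∫ z, log (s z.2 / p m z.2) ∂jointLaw μ ν k s) _
    (fun m => (hstep m).1) (fun m => (hstep m).2.1) (fun m => (hstep m).2.2)

end IsFredholmSolution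

end Mixture

theorem lintegral_ofReal_eq_one_of_integral_eq_one {α : Type*} [MeasurableSpace α] {μ : Measure α}
    {g : α → ℝ} (hg0 : 0 ≤ᵐ[μ] g) (hg : ∫ x, g x ∂μ = 1) : ∫⁻ x, ENNReal.ofReal (g x) ∂μ = 1 := by
  have hi : Integrable g μ := by
    by_contra hn
    simp [integral_undef hn] at hg
  rw [← ofReal_integral_eq_lintegral_ofReal hi hg0, hg, ENNReal.ofReal_one]

theorem KL_mixture_convergence_to_zero
    (X Θ : Set ℝ) (hX : MeasurableSet X) (hΘ : MeasurableSet Θ)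
    (k : ℝ → ℝ → ℝ)
    (hk_meas : Measurable (Function.uncurry k))
    (hk_nonneg : ∀ x θ, 0 ≤ k x θ)
    (hk_dens : ∀ θ ∈ Θ, ∫ x in X, k x θ = 1)
    (f : ℝ → ℝ) (hf_meas : Measurable f)
    (hf_nonneg : ∀ x ∈ X, 0 ≤ f x) (hf_int : ∫ x in X, f x = 1)
    (psol : ℝ → ℝ) (hpsol_meas : Measurable psol)
    (hpsol_nonneg : ∀ θ ∈ Θ, 0 ≤ psol θ) (hpsol_int : ∫ θ in Θ, psol θ = 1)
    (hsol : ∀ᵐ x ∂(volume.restrict X), f x = mix Θ k psol x)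
    (p : ℕ → ℝ → ℝ) (hp_meas : ∀ m, Measurable (p m))
    (hp0_pos : ∀ θ ∈ Θ, 0 < p 0 θ) (hp0_int : ∫ θ in Θ, p 0 θ = 1)
    (hrec : ∀ m : ℕ, ∀ θ ∈ Θ,
      p (m + 1) θ = p m θ * ∫ x in X, k x θ * f x / mix Θ k (p m) x)
    (hfinKL : IntegrableOn (fun θ => psol θ * Real.log (psol θ / p 0 θ)) Θ) :
    Tendsto (fun m => KL X f (mix Θ k (p m))) atTop (nhds 0) := by
  have h : IsFredholmSolution (volume.restrict X) (volume.restrict Θ) k f psol :=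
    { measurable_kernel := hk_meas
      kernel_nonneg := hk_nonneg
      lintegral_kernel := by
        filter_upwards [ae_restrict_mem hΘ] with θ hθ
        exact lintegral_ofReal_eq_one_of_integral_eq_one
          (Eventually.of_forall fun x => hk_nonneg x θ) (hk_dens θ hθ)
      measurable_data := hf_meas
      data_nonneg := ae_restrict_of_forall_mem hX hf_nonneg
      measurable_solution := hpsol_meas
      solution_nonneg := ae_restrict_of_forall_mem hΘ hpsol_nonneg
      lintegral_solution := lintegral_ofReal_eq_one_of_integral_eq_one
        (ae_restrict_of_forall_mem hΘ hpsol_nonneg) hpsol_int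
      equation := hsol }
  have hp0 : ∀ᵐ θ ∂(volume.restrict Θ), 0 < p 0 θ := ae_restrict_of_forall_mem hΘ hp0_pos
  have hp0' : 0 ≤ᵐ[volume.restrict Θ] p 0 := hp0.mono fun _ hθ => hθ.le
  refine h.tendsto_relative_entropy_mixture hp_meas
    ⟨hp_meas 0, hp0', (lintegral_ofReal_eq_one_of_integral_eq_one hp0' hp0_int).le,
      IsFredholmSolution.joint_ae_of_ae_snd hp0⟩ (fun m => ?_) hfinKL
  filter_upwards [ae_restrict_mem hΘ] with θ hθ
  rw [hrec m θ hθ]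
  simp only [mul_div_assoc, mix]
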